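/- Each of the seven generating polynomials g₁,…,g₇ of the ideal 𝒳 vanishes at Π₃(t₁,t₂,t₃) for every (t₁,t₂,t₃) ∈ ℝ³; moreover, for s, t ∈ ℝ³ one has Π₃(t) = Π₃(s) if and only if t − s ∈ ℤ³ or t + s ∈ ℤ³ (so Π₃ factors through the quotient 𝕋³/(±1) of the 3-torus and is injective on it). -/

import Mathlib

open Real

noncomputable section

/-- Coordinates on `ℝ⁷` are `(x₁,x₂,x₃,x₁₂,x₁₃,x₂₃,x₁₂₃)`, indexed `0,…,6`. -/
abbrev R7 := Fin 7 → ℝ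

/-- `Π₃(t₁,t₂,t₃)`. -/
def Pi3 (t₁ t₂ t₃ : ℝ) : R7 :=
  ![Real.cos (2 * π * t₁), Real.cos (2 * π * t₂), Real.cos (2 * π * t₃),
    Real.cos (2 * π * (t₁ + t₂)), Real.cos (2 * π * (t₁ + t₃)),
    Real.cos (2 * π * (t₂ + t₃)), Real.cos (2 * π * (t₁ + t₂ + t₃))]

def g1 (p : R7) : ℝ := p 2 ^ 2 - 2 * p 2 * p 3 * p 6 + p 3 ^ 2 + p 6 ^ 2 - 1
def g2 (p : R7) : ℝ := p 1 ^ 2 - 2 * p 1 * p 4 * p 6 + p 4 ^ 2 + p 6 ^ 2 - 1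
def g3 (p : R7) : ℝ :=
  p 1 * p 2 * p 6 ^ 2 - (1/2) * p 1 * p 2 - (1/2) * p 1 * p 3 * p 6
    - (1/2) * p 2 * p 4 * p 6 + (1/2) * p 3 * p 4 - (1/2) * p 5 * p 6 ^ 2
    + (1/2) * p 5
def g4 (p : R7) : ℝ :=
  p 0 + 2 * p 1 * p 2 * p 6 - p 1 * p 3 - p 2 * p 4 - p 5 * p 6
def g5 (p : R7) : ℝ :=
  p 1 * p 3 * p 5 - 2 * p 1 * p 4 * p 6 ^ 2 + p 1 * p 4 + 2 * p 2 * p 3 * p 6 ^ 2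
    - p 2 * p 3 - p 2 * p 4 * p 5 - p 3 ^ 2 * p 6 + p 4 ^ 2 * p 6
def g6 (p : R7) : ℝ :=
  p 1 * p 2 * p 3 - 2 * p 1 * p 6 ^ 3 + p 1 * p 6 - p 2 * p 5 * p 6
    - p 3 ^ 2 * p 4 + 2 * p 3 * p 5 * p 6 ^ 2 - p 3 * p 5 + p 4 * p 6 ^ 2
def g7 (p : R7) : ℝ :=
  p 1 * p 2 * p 5 - p 1 * p 4 * p 6 - p 2 * p 3 * p 6 + (1/2) * p 3 ^ 2
    + (1/2) * p 4 ^ 2 - (1/2) * p 5 ^ 2 + p 6 ^ 2 - 1/2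

theorem int_of_cos_sin (x y : ℝ) (hc : Real.cos (2 * π * x) = Real.cos (2 * π * y))
    (hs : Real.sin (2 * π * x) = Real.sin (2 * π * y)) : ∃ a : ℤ, x - y = a := by
  have h : Real.cos (2 * π * x - 2 * π * y) = 1 := by
    rw [Real.cos_sub, hc, hs]
    nlinarith [Real.sin_sq_add_cos_sq (2 * π * y)]
  obtain ⟨k, hk⟩ := (Real.cos_eq_one_iff _).1 h
  refine ⟨k, ?_⟩
  have hp : (2 * π) ≠ 0 := by positivity
  apply mul_left_cancel₀ hp
  linarith

theorem int_of_cos_sin_neg (x y : ℝ) (hc : Real.cos (2 * π * x) = Real.cos (2 * π * y))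
    (hs : Real.sin (2 * π * x) = -Real.sin (2 * π * y)) : ∃ a : ℤ, x + y = a := by
  obtain ⟨a, ha⟩ := int_of_cos_sin x (-y) (by rw [hc, mul_neg, Real.cos_neg])
    (by rw [hs, mul_neg, Real.sin_neg])
  exact ⟨a, by linarith⟩

theorem cos_of_sub_int (x y : ℝ) (a : ℤ) (h : x - y = a) :
    Real.cos (2 * π * x) = Real.cos (2 * π * y) := by
  have : 2 * π * x = 2 * π * y + a * (2 * π) := by rw [← h]; ring
  rw [this, Real.cos_add_int_mul_two_pi]

theorem cos_of_add_int (x y : ℝ) (a : ℤ) (h : x + y = a) :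
    Real.cos (2 * π * x) = Real.cos (2 * π * y) := by
  rw [cos_of_sub_int x (-y) a (by linarith), mul_neg, Real.cos_neg]

theorem sign_alg (a b c A B C : ℝ) (ha : a ^ 2 = A ^ 2) (hb : b ^ 2 = B ^ 2) (hc : c ^ 2 = C ^ 2)
    (hab : a * b = A * B) (hac : a * c = A * C) (hbc : b * c = B * C) :
    (a = A ∧ b = B ∧ c = C) ∨ (a = -A ∧ b = -B ∧ c = -C) := by
  rcases sq_eq_sq_iff_eq_or_eq_neg.1 ha with h1 | h1 <;>
  rcases sq_eq_sq_iff_eq_or_eq_neg.1 hb with h2 | h2 <;>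
  rcases sq_eq_sq_iff_eq_or_eq_neg.1 hc with h3 | h3 <;> subst h1 h2 h3 <;> grind

theorem stmt9 :
    (∀ t₁ t₂ t₃ : ℝ,
      g1 (Pi3 t₁ t₂ t₃) = 0 ∧ g2 (Pi3 t₁ t₂ t₃) = 0 ∧ g3 (Pi3 t₁ t₂ t₃) = 0 ∧
      g4 (Pi3 t₁ t₂ t₃) = 0 ∧ g5 (Pi3 t₁ t₂ t₃) = 0 ∧ g6 (Pi3 t₁ t₂ t₃) = 0 ∧
      g7 (Pi3 t₁ t₂ t₃) = 0) ∧
    (∀ t₁ t₂ t₃ s₁ s₂ s₃ : ℝ,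
      Pi3 t₁ t₂ t₃ = Pi3 s₁ s₂ s₃ ↔
        ((∃ a b c : ℤ, t₁ - s₁ = a ∧ t₂ - s₂ = b ∧ t₃ - s₃ = c) ∨
         (∃ a b c : ℤ, t₁ + s₁ = a ∧ t₂ + s₂ = b ∧ t₃ + s₃ = c))) := by
  constructor
  · intro t₁ t₂ t₃
    have e1 : 2 * π * t₁ = 2 * π * (t₁ + t₂ + t₃) - 2 * π * t₂ - 2 * π * t₃ := by ring
    have e2 : 2 * π * (t₁ + t₂) = 2 * π * (t₁ + t₂ + t₃) - 2 * π * t₃ := by ring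
    have e3 : 2 * π * (t₁ + t₃) = 2 * π * (t₁ + t₂ + t₃) - 2 * π * t₂ := by ring
    have e4 : 2 * π * (t₂ + t₃) = 2 * π * t₂ + 2 * π * t₃ := by ring
    have h0 : Pi3 t₁ t₂ t₃ 0 = _ := congrArg Real.cos e1
    have h1 : Pi3 t₁ t₂ t₃ 1 = Real.cos (2 * π * t₂) := rfl
    have h2 : Pi3 t₁ t₂ t₃ 2 = Real.cos (2 * π * t₃) := rfl
    have h3 : Pi3 t₁ t₂ t₃ 3 = _ := congrArg Real.cos e2
    have h4 : Pi3 t₁ t₂ t₃ 4 = _ := congrArg Real.cos e3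
    have h5 : Pi3 t₁ t₂ t₃ 5 = _ := congrArg Real.cos e4
    have h6 : Pi3 t₁ t₂ t₃ 6 = Real.cos (2 * π * (t₁ + t₂ + t₃)) := rfl
    have q1 := Real.sin_sq_add_cos_sq (2 * π * (t₁ + t₂ + t₃))
    have q2 := Real.sin_sq_add_cos_sq (2 * π * t₂)
    have q3 := Real.sin_sq_add_cos_sq (2 * π * t₃)
    simp only [Real.cos_sub, Real.cos_add, Real.sin_sub, Real.sin_add] at h0 h3 h4 h5
    simp only [g1, g2, g3, g4, g5, g6, g7, h0, h1, h2, h3, h4, h5, h6]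
    clear h0 h1 h2 h3 h4 h5 h6 e1 e2 e3 e4
    generalize Real.cos (2 * π * (t₁ + t₂ + t₃)) = u at *
    generalize Real.sin (2 * π * (t₁ + t₂ + t₃)) = u' at *
    generalize Real.cos (2 * π * t₂) = v at *
    generalize Real.sin (2 * π * t₂) = v' at *
    generalize Real.cos (2 * π * t₃) = w at *
    generalize Real.sin (2 * π * t₃) = w' at *
    refine ⟨?_, ?_, ?_, ?_, ?_, ?_, ?_⟩ <;> grind
  · intro t₁ t₂ t₃ s₁ s₂ s₃
    constructor
    · intro h
      have h1 : Real.cos (2 * π * t₁) = Real.cos (2 * π * s₁) := congrFun h 0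
      have h2 : Real.cos (2 * π * t₂) = Real.cos (2 * π * s₂) := congrFun h 1
      have h3 : Real.cos (2 * π * t₃) = Real.cos (2 * π * s₃) := congrFun h 2
      have h12 : Real.cos (2 * π * (t₁ + t₂)) = Real.cos (2 * π * (s₁ + s₂)) := congrFun h 3
      have h13 : Real.cos (2 * π * (t₁ + t₃)) = Real.cos (2 * π * (s₁ + s₃)) := congrFun h 4
      have h23 : Real.cos (2 * π * (t₂ + t₃)) = Real.cos (2 * π * (s₂ + s₃)) := congrFun h 5
      rw [mul_add, mul_add, Real.cos_add, Real.cos_add] at h12 h13 h23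
      rw [h1, h2] at h12
      rw [h1, h3] at h13
      rw [h2, h3] at h23
      rcases sign_alg _ _ _ _ _ _
        (show Real.sin (2 * π * t₁) ^ 2 = Real.sin (2 * π * s₁) ^ 2 by
          rw [Real.sin_sq, Real.sin_sq, h1])
        (show Real.sin (2 * π * t₂) ^ 2 = Real.sin (2 * π * s₂) ^ 2 by
          rw [Real.sin_sq, Real.sin_sq, h2])
        (show Real.sin (2 * π * t₃) ^ 2 = Real.sin (2 * π * s₃) ^ 2 by
          rw [Real.sin_sq, Real.sin_sq, h3])
        (by linarith) (by linarith) (by linarith) with ⟨k1, k2, k3⟩ | ⟨k1, k2, k3⟩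
      · left
        obtain ⟨a, ha⟩ := int_of_cos_sin _ _ h1 k1
        obtain ⟨b, hb⟩ := int_of_cos_sin _ _ h2 k2
        obtain ⟨c, hc⟩ := int_of_cos_sin _ _ h3 k3
        exact ⟨a, b, c, ha, hb, hc⟩
      · right
        obtain ⟨a, ha⟩ := int_of_cos_sin_neg _ _ h1 k1
        obtain ⟨b, hb⟩ := int_of_cos_sin_neg _ _ h2 k2
        obtain ⟨c, hc⟩ := int_of_cos_sin_neg _ _ h3 k3
        exact ⟨a, b, c, ha, hb, hc⟩
    · rintro (⟨a, b, c, ha, hb, hc⟩ | ⟨a, b, c, ha, hb, hc⟩)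
      · unfold Pi3
        rw [cos_of_sub_int t₁ s₁ a ha, cos_of_sub_int t₂ s₂ b hb, cos_of_sub_int t₃ s₃ c hc,
          cos_of_sub_int (t₁ + t₂) (s₁ + s₂) (a + b) (by push_cast; linarith),
          cos_of_sub_int (t₁ + t₃) (s₁ + s₃) (a + c) (by push_cast; linarith),
          cos_of_sub_int (t₂ + t₃) (s₂ + s₃) (b + c) (by push_cast; linarith),
          cos_of_sub_int (t₁ + t₂ + t₃) (s₁ + s₂ + s₃) (a + b + c) (by push_cast; linarith)]
      · unfold Pi3
        rw [cos_of_add_int t₁ s₁ a ha, cos_of_add_int t₂ s₂ b hb, cos_of_add_int t₃ s₃ c hc,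
          cos_of_add_int (t₁ + t₂) (s₁ + s₂) (a + b) (by push_cast; linarith),
          cos_of_add_int (t₁ + t₃) (s₁ + s₃) (a + c) (by push_cast; linarith),
          cos_of_add_int (t₂ + t₃) (s₂ + s₃) (b + c) (by push_cast; linarith),
          cos_of_add_int (t₁ + t₂ + t₃) (s₁ + s₂ + s₃) (a + b + c) (by push_cast; linarith)]

end
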